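/- arXiv:2407.03870 — 2 statements merged into one kernel-verified Lean document; each statement's English description precedes it below -/
import Mathlib

section
/- Let ε > 0, let J : ℝ^d → [0,∞) be integrable with ∫ J = 1, and let u be the unique mild solution of the nonlocal Fokker–Planck equation ∂_t u = (1/ε²)(J_ε * u − u) + div(xu) with nonnegative initial condition u₀ ∈ L¹(ℝ^d). Then for every t ≥ 0, with convergence of the series in L¹(ℝ^d), u(t)(x) = e^{(d − 1/ε²)t} [ u₀(e^t x) + Σ_{n=1}^∞ ε^{−2n} ∫₀^t ∫₀^{t₁} ⋯ ∫₀^{t_{n−1}} (J_ε^{t₁,…,t_n} * u₀)(e^t x) dt_n ⋯ dt₁ ], where J_ε^{t₁,…,t_n} := J_{ε e^{t₁}} * ⋯ * J_{ε e^{t_n}}. -/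
open MeasureTheory Real Filter

noncomputable section

abbrev Ed (d : ℕ) := EuclideanSpace ℝ (Fin d)

/-- Convolution of two functions on `ℝ^d`. -/
def conv {d : ℕ} (J u : Ed d → ℝ) : Ed d → ℝ := fun x => ∫ y, J (x - y) * u y

/-- The scaled kernel `J_c(x) = c^{-d} J(x/c)`. -/
def scaleK {d : ℕ} (J : Ed d → ℝ) (c : ℝ) : Ed d → ℝ := fun x => (c ^ d)⁻¹ * J (c⁻¹ • x)

/-- The semigroup `(T_t u)(x) = e^{(d-1/ε²)t} u(e^t x)`. -/
def Tt {d : ℕ} (ε t : ℝ) (u : Ed d → ℝ) : Ed d → ℝ :=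
  fun x => Real.exp (((d : ℝ) - 1 / ε ^ 2) * t) * u (Real.exp t • x)

/-- Mild solution of the nonlocal Fokker–Planck equation
`∂_t u = (1/ε²)(J_ε * u - u) + div(x u)` on `[0,∞)` with initial datum `u₀`, in the
weighted Lebesgue space with weight `V`: a curve `u ∈ C([0,∞), L¹_V)` satisfying
Duhamel's formula `u(t) = T_t u₀ + (1/ε²) ∫₀ᵗ T_{t-s}[J_ε * u(s)] ds`. -/
def IsMildSolution {d : ℕ} (ε : ℝ) (J : Ed d → ℝ) (V : Ed d → ℝ)
    (u₀ : Ed d → ℝ) (u : ℝ → Ed d → ℝ) : Prop :=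
  (∀ t, AEStronglyMeasurable (u t) volume) ∧
  (∀ t ≥ 0, Integrable (fun x => V x * |u t x|)) ∧
  (∀ t₀ ≥ 0, Tendsto (fun t => ∫ x, V x * |u t x - u t₀ x|) (nhdsWithin t₀ (Set.Ici 0)) (nhds 0)) ∧
  (∀ t ≥ 0, ∀ᵐ x, u t x = Tt ε t u₀ x
      + (1 / ε ^ 2) * ∫ s in Set.Ioc (0:ℝ) t, Tt ε (t - s) (conv (scaleK J ε) (u s)) x)
/-- The `n`-th term of the Wild sum:
`wild ε J u₀ n t = ∫₀ᵗ ∫₀^{t₁} ⋯ ∫₀^{t_{n-1}} (J_{ε e^{t₁}} * ⋯ * J_{ε e^{t_n}}) * u₀ dt_n ⋯ dt₁`,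
written through the recursion `wild (n+1) t = ∫₀ᵗ J_{ε e^s} * (wild n s) ds`. -/
def wild {d : ℕ} (ε : ℝ) (J u₀ : Ed d → ℝ) : ℕ → ℝ → Ed d → ℝ
  | 0 => fun _ x => u₀ x
  | n + 1 => fun t x =>
      ∫ s in Set.Ioc (0:ℝ) t, conv (scaleK J (ε * Real.exp s)) (wild ε J u₀ n s) x

/-- A curve of functions, defined for times `s ≥ 0`, which agrees at each time almost everywhere
with a jointly measurable function. -/
def HasMeasurableVersion {d : ℕ} (f : ℝ → Ed d → ℝ) : Prop :=
  ∃ g : ℝ → Ed d → ℝ, Measurable (Function.uncurry g) ∧ ∀ s ≥ 0, f s =ᵐ[volume] g s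

/-- The Duhamel operator `f ↦ (t ↦ ∫₀ᵗ K(s) * f(s) ds)`. -/
def duhamel {d : ℕ} (K f : ℝ → Ed d → ℝ) : ℝ → Ed d → ℝ :=
  fun t x => ∫ s in Set.Ioc (0 : ℝ) t, conv (K s) (f s) x

section Convolution

variable {d : ℕ}

lemma conv_congr {k k' f f' : Ed d → ℝ} (hk : k =ᵐ[volume] k') (hf : f =ᵐ[volume] f') :
    conv k f = conv k' f' := by
  funext x
  refine integral_congr_ae ?_
  filter_upwards [hf, (quasiMeasurePreserving_sub_left_of_right_invariant volume x).ae hk]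
    with y hy hy'
  simp only [hy, hy']

lemma conv_const_mul (a : ℝ) (k f : Ed d → ℝ) (x : Ed d) :
    conv (fun y => a * k y) f x = a * conv k f x := by
  simp only [conv, mul_assoc, integral_const_mul]

lemma conv_mul_const (a : ℝ) (k f : Ed d → ℝ) (x : Ed d) :
    conv k (fun y => a * f y) x = a * conv k f x := by
  simp only [conv, mul_left_comm _ a, integral_const_mul]

lemma ae_integrable_conv_integrand {k f : Ed d → ℝ} (hk : Integrable k) (hf : Integrable f) :
    ∀ᵐ x, Integrable (fun y => k (x - y) * f y) := by
  have h := (hf.convolution_integrand (ContinuousLinearMap.mul ℝ ℝ) hk).prod_right_ae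
  filter_upwards [h] with x hx
  simpa [mul_comm] using hx

lemma conv_sub_ae {k f g : Ed d → ℝ} (hk : Integrable k) (hf : Integrable f)
    (hg : Integrable g) :
    ∀ᵐ x, conv k (fun y => f y - g y) x = conv k f x - conv k g x := by
  filter_upwards [ae_integrable_conv_integrand hk hf, ae_integrable_conv_integrand hk hg]
    with x hx hx'
  simp only [conv, mul_sub]
  exact integral_sub hx hx'

lemma lintegral_enorm_conv_le {k f : Ed d → ℝ} (hk : AEStronglyMeasurable k)
    (hf : AEStronglyMeasurable f) :
    ∫⁻ x, ‖conv k f x‖ₑ ≤ (∫⁻ x, ‖k x‖ₑ) * ∫⁻ x, ‖f x‖ₑ := by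
  rw [conv_congr hk.ae_eq_mk hf.ae_eq_mk,
    lintegral_congr_ae (f := fun x => ‖k x‖ₑ) (hk.ae_eq_mk.fun_comp enorm),
    lintegral_congr_ae (f := fun x => ‖f x‖ₑ) (hf.ae_eq_mk.fun_comp enorm)]
  have hk' := hk.stronglyMeasurable_mk.measurable
  have hf' := hf.stronglyMeasurable_mk.measurable
  generalize hk.mk k = k' at *
  generalize hf.mk f = f' at *
  calc ∫⁻ x, ‖conv k' f' x‖ₑ ≤ ∫⁻ x, ∫⁻ y, ‖k' (x - y)‖ₑ * ‖f' y‖ₑ := by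
        refine lintegral_mono fun x => (enorm_integral_le_lintegral_enorm _).trans_eq ?_
        simp only [enorm_mul]
    _ = ∫⁻ y, ∫⁻ x, ‖k' (x - y)‖ₑ * ‖f' y‖ₑ :=
        lintegral_lintegral_swap (by unfold Function.uncurry; fun_prop)
    _ = ∫⁻ y, (∫⁻ x, ‖k' x‖ₑ) * ‖f' y‖ₑ := by
        refine lintegral_congr fun y => ?_
        rw [lintegral_mul_const _ (by fun_prop),
          lintegral_sub_right_eq_self (fun x => ‖k' x‖ₑ) y]
    _ = _ := lintegral_const_mul _ (by fun_prop)

end Convolution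

section Duhamel

variable {d : ℕ} {K f g : ℝ → Ed d → ℝ}

lemma HasMeasurableVersion.aestronglyMeasurable (hf : HasMeasurableVersion f) {s : ℝ}
    (hs : 0 ≤ s) : AEStronglyMeasurable (f s) := by
  obtain ⟨g, hg, hfg⟩ := hf
  exact ⟨g s, (hg.comp measurable_prodMk_left).stronglyMeasurable, hfg s hs⟩

lemma HasMeasurableVersion.sub (hf : HasMeasurableVersion f) (hg : HasMeasurableVersion g) :
    HasMeasurableVersion (fun s x => f s x - g s x) := by
  obtain ⟨f', hf', hff'⟩ := hf
  obtain ⟨g', hg', hgg'⟩ := hg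
  exact ⟨fun s x => f' s x - g' s x, hf'.sub hg', fun s hs => (hff' s hs).sub (hgg' s hs)⟩

lemma hasMeasurableVersion_const {f₀ : Ed d → ℝ} (hf₀ : AEStronglyMeasurable f₀) :
    HasMeasurableVersion (fun _ => f₀) :=
  ⟨fun _ => hf₀.mk f₀, hf₀.stronglyMeasurable_mk.measurable.comp measurable_snd,
    fun _ _ => hf₀.ae_eq_mk⟩

/-- Rescaling of a curve in space and in amplitude. -/
lemma HasMeasurableVersion.rescale (hf : HasMeasurableVersion f) {a b : ℝ → ℝ}
    (ha : Measurable a) (hb : Measurable b) (hb0 : ∀ s, b s ≠ 0) :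
    HasMeasurableVersion (fun s x => a s * f s (b s • x)) := by
  obtain ⟨g, hg, hfg⟩ := hf
  refine ⟨fun s x => a s * g s (b s • x), ?_, fun s hs => ?_⟩
  · exact (ha.comp measurable_fst).mul (hg.comp (measurable_fst.prodMk
      ((hb.comp measurable_fst).smul measurable_snd)))
  · filter_upwards [(Measure.quasiMeasurePreserving_smul volume (hb0 s)).ae (hfg s hs)] with x hx
    rw [hx]

lemma HasMeasurableVersion.conv (hK : HasMeasurableVersion K) (hf : HasMeasurableVersion f) :
    ∃ C : ℝ → Ed d → ℝ, Measurable (Function.uncurry C) ∧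
      ∀ s ≥ 0, conv (K s) (f s) = C s := by
  obtain ⟨K', hK', hKK'⟩ := hK
  obtain ⟨f', hf', hff'⟩ := hf
  refine ⟨fun s => _root_.conv (K' s) (f' s), ?_, fun s hs => conv_congr (hKK' s hs) (hff' s hs)⟩
  have h : Measurable fun p : (ℝ × Ed d) × Ed d => K' p.1.1 (p.1.2 - p.2) * f' p.1.1 p.2 :=
    (hK'.comp (f := fun p : (ℝ × Ed d) × Ed d => (p.1.1, p.1.2 - p.2)) (by fun_prop)).mul
      (hf'.comp (f := fun p : (ℝ × Ed d) × Ed d => (p.1.1, p.2)) (by fun_prop))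
  exact h.stronglyMeasurable.integral_prod_right'.measurable

lemma HasMeasurableVersion.duhamel (hK : HasMeasurableVersion K)
    (hf : HasMeasurableVersion f) : HasMeasurableVersion (duhamel K f) := by
  obtain ⟨C, hC, hKC⟩ := hK.conv hf
  refine ⟨_, ?_, fun s _ => EventuallyEq.rfl⟩
  have h : Measurable fun p : (ℝ × Ed d) × ℝ =>
      {q : (ℝ × Ed d) × ℝ | q.2 ∈ Set.Ioc 0 q.1.1}.indicator (fun q => C q.2 q.1.2) p := by
    refine (hC.comp (f := fun p : (ℝ × Ed d) × ℝ => (p.2, p.1.2)) (by fun_prop)).indicator ?_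
    exact (measurableSet_lt measurable_const measurable_snd).inter
      (measurableSet_le measurable_snd (by fun_prop))
  convert (h.stronglyMeasurable.integral_prod_right' (ν := volume)).measurable using 2 with p
  rw [Function.uncurry, _root_.duhamel, ← integral_indicator measurableSet_Ioc]
  congr 1 with s
  by_cases hs : s ∈ Set.Ioc 0 p.1
  · rw [Set.indicator_of_mem hs, Set.indicator_of_mem (by exact hs), hKC s hs.1.le]
  · rw [Set.indicator_of_notMem hs, Set.indicator_of_notMem (by exact hs)]

lemma lintegral_lintegral_enorm_conv_le (hK : HasMeasurableVersion K)
    (hf : HasMeasurableVersion f) (t : ℝ) :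
    ∫⁻ x, ∫⁻ s in Set.Ioc 0 t, ‖conv (K s) (f s) x‖ₑ ≤
      ∫⁻ s in Set.Ioc 0 t, (∫⁻ x, ‖K s x‖ₑ) * ∫⁻ x, ‖f s x‖ₑ := by
  obtain ⟨C, hC, hKC⟩ := hK.conv hf
  calc ∫⁻ x, ∫⁻ s in Set.Ioc 0 t, ‖conv (K s) (f s) x‖ₑ
      = ∫⁻ x, ∫⁻ s in Set.Ioc 0 t, ‖C s x‖ₑ := by
        refine lintegral_congr fun x => setLIntegral_congr_fun measurableSet_Ioc fun s hs => ?_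
        simp only [hKC s hs.1.le]
    _ = ∫⁻ s in Set.Ioc 0 t, ∫⁻ x, ‖C s x‖ₑ :=
        lintegral_lintegral_swap (hC.comp measurable_swap).enorm.aemeasurable
    _ ≤ _ := by
        refine setLIntegral_mono' measurableSet_Ioc fun s hs => ?_
        rw [← hKC s hs.1.le]
        exact lintegral_enorm_conv_le (hK.aestronglyMeasurable hs.1.le)
          (hf.aestronglyMeasurable hs.1.le)

lemma lintegral_enorm_duhamel_le (hK : HasMeasurableVersion K)
    (hf : HasMeasurableVersion f) (t : ℝ) :
    ∫⁻ x, ‖duhamel K f t x‖ₑ ≤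
      ∫⁻ s in Set.Ioc 0 t, (∫⁻ x, ‖K s x‖ₑ) * ∫⁻ x, ‖f s x‖ₑ :=
  (lintegral_mono fun _ => enorm_integral_le_lintegral_enorm _).trans
    (lintegral_lintegral_enorm_conv_le hK hf t)

lemma lintegral_enorm_duhamel_le_pow (hK : HasMeasurableVersion K)
    (hf : HasMeasurableVersion f) {c M T : ℝ} (hc : 0 ≤ c) (hM : 0 ≤ M) {n : ℕ}
    (hKc : ∀ s ≥ 0, ∫⁻ x, ‖K s x‖ₑ ≤ ENNReal.ofReal c)
    (hfM : ∀ s ∈ Set.Icc 0 T, ∫⁻ x, ‖f s x‖ₑ ≤ ENNReal.ofReal (M * (c * s) ^ n / n.factorial)) :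
    ∀ t ∈ Set.Icc 0 T, ∫⁻ x, ‖duhamel K f t x‖ₑ ≤
      ENNReal.ofReal (M * (c * t) ^ (n + 1) / (n + 1).factorial) := by
  intro t ht
  calc ∫⁻ x, ‖duhamel K f t x‖ₑ
      ≤ ∫⁻ s in Set.Ioc 0 t, (∫⁻ x, ‖K s x‖ₑ) * ∫⁻ x, ‖f s x‖ₑ :=
        lintegral_enorm_duhamel_le hK hf t
    _ ≤ ∫⁻ s in Set.Ioc 0 t, ENNReal.ofReal (c * (M * (c * s) ^ n / n.factorial)) := by
        refine setLIntegral_mono' measurableSet_Ioc fun s hs => ?_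
        rw [ENNReal.ofReal_mul hc]
        exact mul_le_mul' (hKc s hs.1.le) (hfM s ⟨hs.1.le, hs.2.trans ht.2⟩)
    _ = ENNReal.ofReal (∫ s in Set.Ioc 0 t, c * (M * (c * s) ^ n / n.factorial)) := by
        refine (ofReal_integral_eq_lintegral_ofReal ?_ ?_).symm
        · exact (Continuous.integrableOn_Icc (by fun_prop)).mono_set Set.Ioc_subset_Icc_self
        · filter_upwards [ae_restrict_mem measurableSet_Ioc] with s hs
          have := hs.1.le
          positivity
    _ = _ := by
        have h : ∀ s : ℝ, c * (M * (c * s) ^ n / n.factorial) =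
            (M * c ^ (n + 1) / n.factorial) * s ^ n := fun s => by ring
        rw [← intervalIntegral.integral_of_le ht.1]
        simp only [h, intervalIntegral.integral_const_mul, integral_pow]
        congr 1
        rw [Nat.factorial_succ]
        push_cast
        field_simp
        ring

lemma ae_integrableOn_conv (hK : HasMeasurableVersion K) (hf : HasMeasurableVersion f)
    {c M : ENNReal} (hc : c ≠ ⊤) (hM : M ≠ ⊤) {t : ℝ}
    (hKc : ∀ s ∈ Set.Ioc 0 t, ∫⁻ x, ‖K s x‖ₑ ≤ c)
    (hfM : ∀ s ∈ Set.Ioc 0 t, ∫⁻ x, ‖f s x‖ₑ ≤ M) :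
    ∀ᵐ x, IntegrableOn (fun s => conv (K s) (f s) x) (Set.Ioc 0 t) := by
  obtain ⟨C, hC, hKC⟩ := hK.conv hf
  have hcongr : ∀ x, ∫⁻ s in Set.Ioc 0 t, ‖conv (K s) (f s) x‖ₑ =
      ∫⁻ s in Set.Ioc 0 t, ‖C s x‖ₑ := fun x =>
    setLIntegral_congr_fun measurableSet_Ioc fun s hs => by simp only [hKC s hs.1.le]
  have hfin : ∫⁻ x, ∫⁻ s in Set.Ioc 0 t, ‖C s x‖ₑ ≠ ⊤ := by
    simp only [← hcongr]
    refine ne_top_of_le_ne_top (b := c * M * volume (Set.Ioc 0 t)) ?_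
      ((lintegral_lintegral_enorm_conv_le hK hf t).trans ?_)
    · exact ENNReal.mul_ne_top (ENNReal.mul_ne_top hc hM) (by simp)
    · rw [← setLIntegral_const]
      exact setLIntegral_mono' measurableSet_Ioc fun s hs => mul_le_mul' (hKc s hs) (hfM s hs)
  have hmeas : Measurable fun x => ∫⁻ s in Set.Ioc 0 t, ‖C s x‖ₑ :=
    (hC.comp measurable_swap).enorm.lintegral_prod_right'
  filter_upwards [ae_lt_top hmeas hfin] with x hx
  have hint : IntegrableOn (fun s => C s x) (Set.Ioc 0 t) :=
    ⟨(hC.comp measurable_prodMk_right).aestronglyMeasurable, hx⟩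
  exact hint.congr_fun (fun s hs => by simp only [hKC s hs.1.le]) measurableSet_Ioc

lemma duhamel_sub_ae (hK : HasMeasurableVersion K) (hf : HasMeasurableVersion f)
    (hg : HasMeasurableVersion g) {c M M' : ENNReal} (hc : c ≠ ⊤) (hM : M ≠ ⊤) (hM' : M' ≠ ⊤)
    {t : ℝ} (hKc : ∀ s ∈ Set.Ioc 0 t, ∫⁻ x, ‖K s x‖ₑ ≤ c)
    (hfM : ∀ s ∈ Set.Ioc 0 t, ∫⁻ x, ‖f s x‖ₑ ≤ M)
    (hgM : ∀ s ∈ Set.Ioc 0 t, ∫⁻ x, ‖g s x‖ₑ ≤ M') :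
    ∀ᵐ x, duhamel K (fun s y => f s y - g s y) t x = duhamel K f t x - duhamel K g t x := by
  have hint : ∀ {h : ℝ → Ed d → ℝ} {m : ENNReal}, HasMeasurableVersion h → m ≠ ⊤ →
      (∀ s ∈ Set.Ioc 0 t, ∫⁻ x, ‖h s x‖ₑ ≤ m) → ∀ s ∈ Set.Ioc 0 t, Integrable (h s) :=
    fun hh hm hhm s hs => ⟨hh.aestronglyMeasurable hs.1.le, (hhm s hs).trans_lt hm.lt_top⟩
  obtain ⟨C, hC, hKC⟩ := hK.conv (hf.sub hg)
  obtain ⟨C₁, hC₁, hKC₁⟩ := hK.conv hf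
  obtain ⟨C₂, hC₂, hKC₂⟩ := hK.conv hg
  have hslice : ∀ᵐ s ∂volume.restrict (Set.Ioc 0 t), ∀ᵐ x, C s x = C₁ s x - C₂ s x := by
    filter_upwards [ae_restrict_mem measurableSet_Ioc] with s hs
    have h := conv_sub_ae (hint hK hc hKc s hs) (hint hf hM hfM s hs) (hint hg hM' hgM s hs)
    simpa only [hKC s hs.1.le, hKC₁ s hs.1.le, hKC₂ s hs.1.le] using h
  have hswap : ∀ᵐ x, ∀ᵐ s ∂volume.restrict (Set.Ioc 0 t), C s x = C₁ s x - C₂ s x :=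
    (Measure.ae_ae_comm (p := fun s x => C s x = C₁ s x - C₂ s x)
      (measurableSet_eq_fun hC (hC₁.sub hC₂))).1 hslice
  filter_upwards [hswap, ae_integrableOn_conv hK hf hc hM hKc hfM,
    ae_integrableOn_conv hK hg hc hM' hKc hgM] with x hx h₁ h₂
  rw [duhamel, duhamel, duhamel, ← integral_sub h₁ h₂]
  refine integral_congr_ae ?_
  filter_upwards [hx, ae_restrict_mem measurableSet_Ioc] with s hs hst
  rw [hKC s hst.1.le, hKC₁ s hst.1.le, hKC₂ s hst.1.le, hs]

end Duhamel

section ContinuousCurve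

variable {d : ℕ} {u : ℝ → Ed d → ℝ}

lemma tendsto_setIntegral_of_tendsto_L1 {l : Filter ℝ} {t₀ : ℝ}
    (hint : ∀ t ≥ 0, Integrable (u t)) (ht₀ : 0 ≤ t₀) (hl : ∀ᶠ t in l, 0 ≤ t)
    (hcont : Tendsto (fun t => ∫ x, |u t x - u t₀ x|) l (nhds 0)) (B : Set (Ed d)) :
    Tendsto (fun t => ∫ x in B, u t x) l (nhds (∫ x in B, u t₀ x)) := by
  rw [tendsto_iff_norm_sub_tendsto_zero]
  refine squeeze_zero' (Eventually.of_forall fun _ => norm_nonneg _) ?_ hcont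
  filter_upwards [hl] with t ht
  rw [← integral_sub (hint t ht).integrableOn (hint t₀ ht₀).integrableOn]
  refine (norm_integral_le_integral_norm _).trans ?_
  exact setIntegral_le_integral ((hint t ht).sub (hint t₀ ht₀)).norm
    (Eventually.of_forall fun _ => norm_nonneg _)

lemma tendsto_integral_abs_of_tendsto_L1 {l : Filter ℝ} {t₀ : ℝ}
    (hint : ∀ t ≥ 0, Integrable (u t)) (ht₀ : 0 ≤ t₀) (hl : ∀ᶠ t in l, 0 ≤ t)
    (hcont : Tendsto (fun t => ∫ x, |u t x - u t₀ x|) l (nhds 0)) :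
    Tendsto (fun t => ∫ x, |u t x|) l (nhds (∫ x, |u t₀ x|)) := by
  rw [tendsto_iff_norm_sub_tendsto_zero]
  refine squeeze_zero' (Eventually.of_forall fun _ => norm_nonneg _) ?_ hcont
  filter_upwards [hl] with t ht
  rw [← integral_sub (hint t ht).abs (hint t₀ ht₀).abs]
  refine (norm_integral_le_integral_norm _).trans ?_
  exact integral_mono ((hint t ht).abs.sub (hint t₀ ht₀).abs).norm
    ((hint t ht).sub (hint t₀ ht₀)).abs fun x => abs_abs_sub_abs_le _ _

/-- A continuous curve in `L¹` has a jointly measurable version, obtained from the Lebesgue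
differentiation theorem. -/
lemma hasMeasurableVersion_of_continuous_L1 (hint : ∀ t ≥ 0, Integrable (u t))
    (hcont : ∀ t₀ ≥ 0, Tendsto (fun t => ∫ x, |u t x - u t₀ x|)
      (nhdsWithin t₀ (Set.Ici 0)) (nhds 0)) :
    HasMeasurableVersion u := by
  let r : ℕ → ℝ := fun n => 1 / ((n : ℝ) + 1)
  let A : ℕ → ℝ → Ed d → ℝ := fun n s x => ⨍ y in Metric.closedBall x (r n), u (max s 0) y
  have hA : ∀ n, Measurable (Function.uncurry (A n)) := by
    intro n
    have hsm : StronglyMeasurable (Function.uncurry fun (s : ℝ) (x : Ed d) =>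
        ∫ y in Metric.closedBall x (r n), u (max s 0) y) := by
      refine stronglyMeasurable_uncurry_of_continuous_of_stronglyMeasurable (fun x => ?_)
        fun s => ?_
      · refine continuous_iff_continuousAt.2 fun s₀ => ?_
        have hmax : Tendsto (fun s : ℝ => max s 0) (nhds s₀)
            (nhdsWithin (max s₀ 0) (Set.Ici 0)) :=
          tendsto_nhdsWithin_iff.2 ⟨(by fun_prop : Continuous fun s : ℝ => max s 0).tendsto s₀,
            Eventually.of_forall fun s => le_max_right s 0⟩
        exact (tendsto_setIntegral_of_tendsto_L1 hint (le_max_right _ _)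
          self_mem_nhdsWithin (hcont _ (le_max_right _ _)) _).comp hmax
      · have hu := (hint (max s 0) (le_max_right _ _)).aestronglyMeasurable
        have hm : Measurable fun p : Ed d × Ed d =>
            {q : Ed d × Ed d | dist q.2 q.1 ≤ r n}.indicator (fun q => hu.mk _ q.2) p :=
          (hu.stronglyMeasurable_mk.measurable.comp measurable_snd).indicator
            (measurableSet_le (by fun_prop) measurable_const)
        convert hm.stronglyMeasurable.integral_prod_right' (ν := volume) using 2 with x
        rw [integral_congr_ae (ae_restrict_of_ae hu.ae_eq_mk),
          ← integral_indicator Metric.isClosed_closedBall.measurableSet]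
        rfl
    have hvol : ∀ x : Ed d, volume.real (Metric.closedBall x (r n)) =
        volume.real (Metric.closedBall (0 : Ed d) (r n)) := fun x => by
      rw [Measure.real, Measure.real, Measure.addHaar_closedBall_center]
    have : Function.uncurry (A n) = fun p => (volume.real (Metric.closedBall (0 : Ed d) (r n)))⁻¹ *
        (Function.uncurry fun (s : ℝ) (x : Ed d) =>
          ∫ y in Metric.closedBall x (r n), u (max s 0) y) p := by
      funext p
      simp only [A, Function.uncurry, setAverage_eq, hvol, smul_eq_mul]
    rw [this]
    exact hsm.measurable.const_mul _
  refine ⟨fun s x => limsup (fun n => A n s x) atTop, Measurable.limsup hA, fun s hs => ?_⟩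
  have hr : Tendsto r atTop (nhdsWithin 0 (Set.Ioi 0)) :=
    tendsto_nhdsWithin_iff.2 ⟨tendsto_one_div_add_atTop_nhds_zero_nat,
      Eventually.of_forall fun n => Set.mem_Ioi.2 (by positivity)⟩
  filter_upwards [IsUnifLocDoublingMeasure.ae_tendsto_average volume
    (hint s hs).locallyIntegrable 1] with x hx
  have hlim := hx (fun _ => x) r hr (Eventually.of_forall fun n =>
    Metric.mem_closedBall_self (by positivity))
  have hlim' : Tendsto (fun n => A n s x) atTop (nhds (u s x)) := by
    simpa only [A, max_eq_left hs] using hlim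
  exact hlim'.limsup_eq.symm

lemma exists_integral_abs_le_of_continuous_L1 (hint : ∀ t ≥ 0, Integrable (u t))
    (hcont : ∀ t₀ ≥ 0, Tendsto (fun t => ∫ x, |u t x - u t₀ x|)
      (nhdsWithin t₀ (Set.Ici 0)) (nhds 0)) (T : ℝ) :
    ∃ B, 0 ≤ B ∧ ∀ s ∈ Set.Icc 0 T, ∫ x, |u s x| ≤ B := by
  have hc : ContinuousOn (fun t => ∫ x, |u t x|) (Set.Icc 0 T) := fun s hs =>
    (tendsto_integral_abs_of_tendsto_L1 hint hs.1 self_mem_nhdsWithin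
      (hcont s hs.1)).mono_left (nhdsWithin_mono _ Set.Icc_subset_Ici_self)
  obtain ⟨B, hB⟩ := isCompact_Icc.exists_bound_of_continuousOn hc
  exact ⟨max B 0, le_max_right _ _, fun s hs =>
    (le_abs_self _).trans ((hB s hs).trans (le_max_left _ _))⟩

end ContinuousCurve

section Scaling

variable {d : ℕ} {J : Ed d → ℝ}

lemma lintegral_enorm_scaleK (hJnn : ∀ x, 0 ≤ J x) (hJ : Integrable J) {c : ℝ} (hc : 0 < c) :
    ∫⁻ x, ‖scaleK J c x‖ₑ = ENNReal.ofReal (∫ x, J x) := by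
  have hint : Integrable (scaleK J c) := (hJ.comp_smul (inv_ne_zero hc.ne')).const_mul _
  have hnn : ∀ x, 0 ≤ scaleK J c x := fun x => mul_nonneg (by positivity) (hJnn _)
  rw [← ofReal_integral_norm_eq_lintegral_enorm hint]
  simp only [Real.norm_of_nonneg (hnn _)]
  simp only [scaleK, integral_const_mul]
  rw [Measure.integral_comp_inv_smul_of_nonneg volume J hc.le, finrank_euclideanSpace_fin,
    smul_eq_mul, inv_mul_cancel_left₀ (pow_pos hc d).ne']

lemma conv_scaleK_inv_smul (f : Ed d → ℝ) {b : ℝ} (hb : 0 < b) (c : ℝ) (y : Ed d) :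
    conv (scaleK J c) f (b⁻¹ • y) = conv (scaleK J (c * b)) (fun z => f (b⁻¹ • z)) y := by
  have h : ∀ z, scaleK J (c * b) (y - z) * f (b⁻¹ • z) =
      (b ^ d)⁻¹ * (fun z' => scaleK J c (b⁻¹ • y - z') * f z') (b⁻¹ • z) := fun z => by
    simp only [scaleK, mul_pow, mul_inv, mul_smul, smul_sub]
    ring
  simp only [conv]
  rw [integral_congr_ae (Eventually.of_forall h), integral_const_mul,
    Measure.integral_comp_inv_smul_of_nonneg volume
      (fun z' => scaleK J c (b⁻¹ • y - z') * f z') hb.le, finrank_euclideanSpace_fin,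
    smul_eq_mul, inv_mul_cancel_left₀ (pow_pos hb d).ne']

lemma integral_abs_comp_exp_smul (f : Ed d → ℝ) (t : ℝ) :
    ∫ x, |f (exp t • x)| = exp (-(d * t)) * ∫ x, |f x| := by
  rw [Measure.integral_comp_smul_of_nonneg volume (fun x => |f x|) (exp t)
    (hR := (exp_pos t).le), finrank_euclideanSpace_fin, smul_eq_mul, ← exp_nat_mul, ← exp_neg]

end Scaling

section Wild

variable {d : ℕ} {ε : ℝ} {J u₀ : Ed d → ℝ} {u : ℝ → Ed d → ℝ}

/-- The kernel `ε⁻² J_{ε e^s}` of the Duhamel formula in self-similar variables. -/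
def wildKernel (ε : ℝ) (J : Ed d → ℝ) : ℝ → Ed d → ℝ :=
  fun s y => (1 / ε ^ 2) * scaleK J (ε * exp s) y

/-- The solution in self-similar variables: `w(t)(y) = e^{-(d-1/ε²)t} u(t)(e^{-t} y)`. -/
def selfSimilar (ε : ℝ) (u : ℝ → Ed d → ℝ) : ℝ → Ed d → ℝ :=
  fun t y => exp (-(((d : ℝ) - 1 / ε ^ 2) * t)) * u t (exp (-t) • y)

/-- The curve `w` minus the first `n` terms of the Wild sum. -/
def wildRemainder (ε : ℝ) (J u₀ : Ed d → ℝ) (w : ℝ → Ed d → ℝ) (n : ℕ) : ℝ → Ed d → ℝ :=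
  fun t y => w t y - ∑ k ∈ Finset.range n, (ε ^ (2 * k))⁻¹ * wild ε J u₀ k t y

lemma hasMeasurableVersion_wildKernel (hε : 0 < ε) (hJ : Integrable J) :
    HasMeasurableVersion (wildKernel ε J) := by
  have h := (hasMeasurableVersion_const hJ.aestronglyMeasurable).rescale
    (a := fun s => (1 / ε ^ 2) * ((ε * exp s) ^ d)⁻¹) (b := fun s => (ε * exp s)⁻¹)
    (by fun_prop) (by fun_prop) fun s => by positivity
  unfold wildKernel scaleK
  simpa only [mul_assoc] using h

lemma lintegral_enorm_wildKernel (hε : 0 < ε) (hJnn : ∀ x, 0 ≤ J x) (hJ : Integrable J)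
    (hJone : ∫ x, J x = 1) (s : ℝ) :
    ∫⁻ x, ‖wildKernel ε J s x‖ₑ = ENNReal.ofReal (1 / ε ^ 2) := by
  simp only [wildKernel, enorm_mul]
  rw [lintegral_const_mul' _ _ enorm_ne_top, lintegral_enorm_scaleK hJnn hJ (by positivity),
    hJone, ENNReal.ofReal_one, mul_one, Real.enorm_of_nonneg (by positivity)]

lemma wild_succ_eq_duhamel (n : ℕ) (t : ℝ) (y : Ed d) :
    (ε ^ (2 * (n + 1)))⁻¹ * wild ε J u₀ (n + 1) t y =
      duhamel (wildKernel ε J) (fun s z => (ε ^ (2 * n))⁻¹ * wild ε J u₀ n s z) t y := by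
  have h : ∀ s, conv (wildKernel ε J s) (fun z => (ε ^ (2 * n))⁻¹ * wild ε J u₀ n s z) y =
      (ε ^ (2 * (n + 1)))⁻¹ * conv (scaleK J (ε * exp s)) (wild ε J u₀ n s) y := fun s => by
    rw [conv_mul_const]
    unfold wildKernel
    rw [conv_const_mul, ← mul_assoc]
    congr 1
    rw [mul_add, pow_add, mul_inv, mul_one, one_div]
  simp only [duhamel, h, integral_const_mul]
  rfl

lemma hasMeasurableVersion_wild (hε : 0 < ε) (hJ : Integrable J) (hu₀ : Integrable u₀) (n : ℕ) :
    HasMeasurableVersion (fun s z => (ε ^ (2 * n))⁻¹ * wild ε J u₀ n s z) := by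
  induction n with
  | zero => simpa [wild] using hasMeasurableVersion_const hu₀.aestronglyMeasurable
  | succ n ih =>
    simp only [wild_succ_eq_duhamel]
    exact (hasMeasurableVersion_wildKernel hε hJ).duhamel ih

lemma lintegral_enorm_wild_le (hε : 0 < ε) (hJnn : ∀ x, 0 ≤ J x) (hJ : Integrable J)
    (hJone : ∫ x, J x = 1) (hu₀ : Integrable u₀) (T : ℝ) (n : ℕ) :
    ∀ s ∈ Set.Icc 0 T, ∫⁻ z, ‖(ε ^ (2 * n))⁻¹ * wild ε J u₀ n s z‖ₑ ≤
      ENNReal.ofReal ((∫ x, |u₀ x|) * (1 / ε ^ 2 * s) ^ n / n.factorial) := by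
  induction n with
  | zero =>
    intro s _
    simpa [wild] using (ofReal_integral_norm_eq_lintegral_enorm hu₀).ge
  | succ n ih =>
    simp only [wild_succ_eq_duhamel]
    exact lintegral_enorm_duhamel_le_pow (hasMeasurableVersion_wildKernel hε hJ)
      (hasMeasurableVersion_wild hε hJ hu₀ n) (by positivity)
      (integral_nonneg fun _ => abs_nonneg _)
      (fun s _ => (lintegral_enorm_wildKernel hε hJnn hJ hJone s).le) ih

lemma wildRemainder_succ (w : ℝ → Ed d → ℝ) (n : ℕ) (t : ℝ) (y : Ed d) :
    wildRemainder ε J u₀ w (n + 1) t y =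
      wildRemainder ε J u₀ w n t y - (ε ^ (2 * n))⁻¹ * wild ε J u₀ n t y := by
  rw [wildRemainder, wildRemainder, Finset.sum_range_succ]
  ring

lemma hasMeasurableVersion_wildRemainder (hε : 0 < ε) (hJ : Integrable J) (hu₀ : Integrable u₀)
    {w : ℝ → Ed d → ℝ} (hw : HasMeasurableVersion w) (n : ℕ) :
    HasMeasurableVersion (wildRemainder ε J u₀ w n) := by
  induction n with
  | zero =>
    unfold wildRemainder
    simpa using hw
  | succ n ih =>
    have h : wildRemainder ε J u₀ w (n + 1) = fun t y =>
        wildRemainder ε J u₀ w n t y - (ε ^ (2 * n))⁻¹ * wild ε J u₀ n t y :=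
      funext fun t => funext fun y => wildRemainder_succ w n t y
    rw [h]
    exact ih.sub (hasMeasurableVersion_wild hε hJ hu₀ n)

/-- Successive remainders of a solution of the Duhamel formula are obtained from one another by
the Duhamel operator, hence decay factorially. -/
lemma wildRemainder_succ_ae_eq (hε : 0 < ε) (hJnn : ∀ x, 0 ≤ J x) (hJ : Integrable J)
    (hJone : ∫ x, J x = 1) (hu₀ : Integrable u₀) {w : ℝ → Ed d → ℝ}
    (hw : HasMeasurableVersion w) {M T : ℝ} (hM : 0 ≤ M)
    (hwM : ∀ s ∈ Set.Icc 0 T, ∫⁻ x, ‖w s x‖ₑ ≤ ENNReal.ofReal M)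
    (hduh : ∀ t ≥ 0, ∀ᵐ y, w t y = u₀ y + duhamel (wildKernel ε J) w t y) (n : ℕ) :
    (∀ t ∈ Set.Icc 0 T, ∫⁻ x, ‖wildRemainder ε J u₀ w n t x‖ₑ ≤
      ENNReal.ofReal (M * (1 / ε ^ 2 * t) ^ n / n.factorial)) ∧
    ∀ t ∈ Set.Icc 0 T, ∀ᵐ y, wildRemainder ε J u₀ w (n + 1) t y =
      duhamel (wildKernel ε J) (wildRemainder ε J u₀ w n) t y := by
  have hK := hasMeasurableVersion_wildKernel hε hJ
  have hKc := lintegral_enorm_wildKernel hε hJnn hJ hJone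
  have hR := hasMeasurableVersion_wildRemainder hε hJ hu₀ hw
  induction n with
  | zero =>
    have h0 : wildRemainder ε J u₀ w 0 = w := by
      funext t y
      simp [wildRemainder]
    refine ⟨by simpa [h0] using hwM, fun t ht => ?_⟩
    filter_upwards [hduh t ht.1] with y hy
    rw [wildRemainder_succ, h0, hy]
    simp [wild]
  | succ n ih =>
    have hbound : ∀ t ∈ Set.Icc 0 T, ∫⁻ x, ‖wildRemainder ε J u₀ w (n + 1) t x‖ₑ ≤
        ENNReal.ofReal (M * (1 / ε ^ 2 * t) ^ (n + 1) / (n + 1).factorial) := fun t ht => by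
      rw [lintegral_congr_ae ((ih.2 t ht).mono fun y hy => congrArg enorm hy)]
      exact lintegral_enorm_duhamel_le_pow hK (hR n) (by positivity) hM
        (fun s _ => (hKc s).le) ih.1 t ht
    refine ⟨hbound, fun t ht => ?_⟩
    have hmono : ∀ {m : ℝ}, 0 ≤ m → ∀ s ∈ Set.Ioc 0 t,
        ENNReal.ofReal (m * (1 / ε ^ 2 * s) ^ n / n.factorial) ≤
          ENNReal.ofReal (m * (1 / ε ^ 2 * t) ^ n / n.factorial) := fun hm s hs => by
      have h₁ := hs.1.le
      have h₂ := hs.2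
      gcongr
    have hsub := duhamel_sub_ae hK (hR n) (hasMeasurableVersion_wild hε hJ hu₀ n)
      ENNReal.ofReal_ne_top ENNReal.ofReal_ne_top ENNReal.ofReal_ne_top
      (fun s _ => (hKc s).le)
      (fun s hs => (ih.1 s ⟨hs.1.le, hs.2.trans ht.2⟩).trans (hmono hM s hs))
      (fun s hs => (lintegral_enorm_wild_le hε hJnn hJ hJone hu₀ T n s
        ⟨hs.1.le, hs.2.trans ht.2⟩).trans (hmono (integral_nonneg fun _ => abs_nonneg _) s hs))
    filter_upwards [ih.2 t ht, hsub] with y hy hy'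
    rw [wildRemainder_succ, hy, wild_succ_eq_duhamel, ← hy']
    congr 1
    funext s z
    exact (wildRemainder_succ w n s z).symm

lemma eq_exp_mul_selfSimilar (t : ℝ) (x : Ed d) :
    u t x = exp (((d : ℝ) - 1 / ε ^ 2) * t) * selfSimilar ε u t (exp t • x) := by
  rw [selfSimilar, ← mul_assoc, ← exp_add, smul_smul, ← exp_add]
  simp

lemma selfSimilar_ae_eq {t : ℝ} (hmild : ∀ᵐ x, u t x = Tt ε t u₀ x
      + (1 / ε ^ 2) * ∫ s in Set.Ioc (0 : ℝ) t, Tt ε (t - s) (conv (scaleK J ε) (u s)) x) :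
    ∀ᵐ y, selfSimilar ε u t y = u₀ y + duhamel (wildKernel ε J) (selfSimilar ε u) t y := by
  filter_upwards [(Measure.quasiMeasurePreserving_smul volume (exp_pos (-t)).ne').ae hmild]
    with y hy
  have hconv : ∀ s, exp (-(((d : ℝ) - 1 / ε ^ 2) * t)) * ((1 / ε ^ 2) *
      Tt ε (t - s) (conv (scaleK J ε) (u s)) (exp (-t) • y)) =
      conv (wildKernel ε J s) (selfSimilar ε u s) y := fun s => by
    unfold wildKernel selfSimilar
    rw [conv_const_mul, conv_mul_const, Tt, smul_smul, ← exp_add, exp_neg s,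
      ← conv_scaleK_inv_smul _ (exp_pos s), ← exp_neg]
    rw [show t - s + -t = -s by ring, show -(((d : ℝ) - 1 / ε ^ 2) * s) =
      -(((d : ℝ) - 1 / ε ^ 2) * t) + ((d : ℝ) - 1 / ε ^ 2) * (t - s) by ring, exp_add]
    ring
  rw [duhamel]
  simp only [← hconv, integral_const_mul]
  rw [selfSimilar, hy, mul_add, Tt, smul_smul, ← mul_assoc, ← exp_add, ← exp_add]
  simp

end Wild

/-- Theorem 2.7 (Wild sum representation): the mild solution of the nonlocal
Fokker–Planck equation with nonnegative integrable initial datum `u₀` is given by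
`u(t)(x) = e^{(d-1/ε²)t} Σ_{n≥0} ε^{-2n} (wild term)_n (e^t x)`, the series converging
in `L¹(ℝ^d)`. -/
theorem wild_sum_representation (d : ℕ) (ε : ℝ) (hε : 0 < ε)
    (J : Ed d → ℝ) (hJnn : ∀ x, 0 ≤ J x) (hJ : Integrable J) (hJone : ∫ x, J x = 1)
    (u₀ : Ed d → ℝ) (hu₀ : Integrable u₀) (hu₀nn : ∀ x, 0 ≤ u₀ x)
    (u : ℝ → Ed d → ℝ) (hu : IsMildSolution ε J (fun _ => 1) u₀ u) :
    ∀ t ≥ 0,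
      Tendsto (fun N : ℕ => ∫ x, |u t x -
          Real.exp (((d : ℝ) - 1 / ε ^ 2) * t) *
            ∑ n ∈ Finset.range (N + 1),
              (ε ^ (2 * n))⁻¹ * wild ε J u₀ n t (Real.exp t • x)|)
        atTop (nhds 0) := by
  obtain ⟨hu_meas, hu_int, hu_cont, hu_mild⟩ := hu
  simp only [one_mul] at hu_int hu_cont
  have hint : ∀ t ≥ 0, Integrable (u t) := fun t ht =>
    (integrable_norm_iff (hu_meas t)).1 (hu_int t ht)
  intro t ht
  have hw : HasMeasurableVersion (selfSimilar ε u) :=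
    (hasMeasurableVersion_of_continuous_L1 hint hu_cont).rescale (by fun_prop) (by fun_prop)
      fun s => (exp_pos (-s)).ne'
  obtain ⟨B, hB0, hB⟩ := exists_integral_abs_le_of_continuous_L1 hint hu_cont t
  have hwM : ∀ s ∈ Set.Icc 0 t, ∫⁻ x, ‖selfSimilar ε u s x‖ₑ ≤
      ENNReal.ofReal (exp (1 / ε ^ 2 * t) * B) := fun s hs => by
    have hws : Integrable (selfSimilar ε u s) :=
      ((hint s hs.1).comp_smul (exp_pos (-s)).ne').const_mul _
    rw [← ofReal_integral_norm_eq_lintegral_enorm hws]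
    refine ENNReal.ofReal_le_ofReal ?_
    simp only [selfSimilar, norm_mul, norm_eq_abs, abs_exp, integral_const_mul,
      integral_abs_comp_exp_smul (u s)]
    rw [← mul_assoc, ← exp_add]
    refine mul_le_mul (exp_le_exp.2 ?_) (hB s hs) (integral_nonneg fun _ => abs_nonneg _)
      (exp_pos _).le
    have := mul_le_mul_of_nonneg_left hs.2 (by positivity : 0 ≤ 1 / ε ^ 2)
    linarith
  have hbound := fun n => (wildRemainder_succ_ae_eq hε hJnn hJ hJone hu₀ hw (by positivity) hwM
    (fun s hs => selfSimilar_ae_eq (hu_mild s hs)) n).1 t ⟨ht, le_rfl⟩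
  have herr : ∀ N : ℕ, ∫ x, |u t x - Real.exp (((d : ℝ) - 1 / ε ^ 2) * t) *
      ∑ n ∈ Finset.range (N + 1), (ε ^ (2 * n))⁻¹ * wild ε J u₀ n t (Real.exp t • x)| =
      exp (-(1 / ε ^ 2 * t)) * ∫ x, |wildRemainder ε J u₀ (selfSimilar ε u) (N + 1) t x| := by
    intro N
    have h : ∀ x, |u t x - Real.exp (((d : ℝ) - 1 / ε ^ 2) * t) *
        ∑ n ∈ Finset.range (N + 1), (ε ^ (2 * n))⁻¹ * wild ε J u₀ n t (Real.exp t • x)| =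
        exp (((d : ℝ) - 1 / ε ^ 2) * t) *
          |wildRemainder ε J u₀ (selfSimilar ε u) (N + 1) t (exp t • x)| := fun x => by
      rw [eq_exp_mul_selfSimilar (ε := ε) (u := u) t x, ← mul_sub, abs_mul, abs_exp]
      rfl
    simp only [h, integral_const_mul, integral_abs_comp_exp_smul
      (wildRemainder ε J u₀ (selfSimilar ε u) (N + 1) t)]
    rw [← mul_assoc, ← exp_add]
    congr 2
    ring
  simp only [herr]
  have hrem : ∀ N : ℕ, ∫ x, |wildRemainder ε J u₀ (selfSimilar ε u) (N + 1) t x| ≤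
      exp (1 / ε ^ 2 * t) * B * ((1 / ε ^ 2 * t) ^ (N + 1) / (N + 1).factorial) := fun N => by
    have hm := (hasMeasurableVersion_wildRemainder hε hJ hu₀ hw (N + 1)).aestronglyMeasurable ht
    rw [← mul_div_assoc, ← ENNReal.ofReal_le_ofReal_iff (by positivity)]
    have hi : Integrable (wildRemainder ε J u₀ (selfSimilar ε u) (N + 1) t) :=
      ⟨hm, (hbound (N + 1)).trans_lt ENNReal.ofReal_lt_top⟩
    exact (ofReal_integral_norm_eq_lintegral_enorm hi).trans_le (hbound (N + 1))
  have hlim : Tendsto (fun N : ℕ => exp (1 / ε ^ 2 * t) * B *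
      ((1 / ε ^ 2 * t) ^ (N + 1) / (N + 1).factorial)) atTop (nhds 0) := by
    simpa only [mul_zero, Function.comp_def] using ((FloorSemiring.tendsto_pow_div_factorial_atTop (1 / ε ^ 2 * t)).comp
      (tendsto_add_atTop_nat 1)).const_mul (exp (1 / ε ^ 2 * t) * B)
  simpa only [mul_zero] using (squeeze_zero (fun N => integral_nonneg fun _ => abs_nonneg _) hrem
    hlim).const_mul (exp (-(1 / ε ^ 2 * t)))
end
end

section
/- Let J : ℝ^d → [0,∞) satisfy ∫ J = 1, ∫ J(x) x dx = 0, ∫ J(x) x_i x_j dx = 2δ_{ij}, and assume ∫ J(x) e^{a'|x|} dx < ∞ for some a' > 0. Then for every 0 < a < a' there exist constants C, λ > 0 depending only on a, d and J (in particular independent of ε) such that for every ε ∈ (0,1] and every x ∈ ℝ^d: (1/ε²) ∫_{ℝ^d} J(z) (e^{a⟨x−εz⟩} − e^{a⟨x⟩}) dz − a (|x|²/⟨x⟩) e^{a⟨x⟩} ≤ C − λ e^{a⟨x⟩}. -/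
open MeasureTheory Real Filter

noncomputable section

/-- ⟨x⟩ = (1+|x|²)^{1/2} -/
def jap {d : ℕ} (x : Ed d) : ℝ := Real.sqrt (1 + ‖x‖ ^ 2)

lemma sq_jap {d : ℕ} (x : Ed d) : jap x ^ 2 = 1 + ‖x‖ ^ 2 :=
  Real.sq_sqrt (by positivity)

lemma one_le_jap {d : ℕ} (x : Ed d) : 1 ≤ jap x :=
  Real.one_le_sqrt.2 (by nlinarith [sq_nonneg ‖x‖])

lemma norm_le_jap {d : ℕ} (x : Ed d) : ‖x‖ ≤ jap x :=
  Real.le_sqrt_of_sq_le (by linarith)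

lemma continuous_jap {d : ℕ} : Continuous (jap : Ed d → ℝ) := by
  unfold jap
  fun_prop

lemma jap_le_add_norm {d : ℕ} (x y : Ed d) : jap y ≤ jap x + ‖y - x‖ := by
  have hx := one_le_jap x
  refine Real.sqrt_le_iff.2 ⟨by positivity, ?_⟩
  have h : ‖y‖ ≤ ‖x‖ + ‖y - x‖ := by
    simpa using norm_add_le x (y - x)
  nlinarith [sq_jap x, norm_le_jap x, norm_nonneg y, norm_nonneg x, norm_nonneg (y - x),
    mul_le_mul_of_nonneg_right (norm_le_jap x) (norm_nonneg (y - x))]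

lemma abs_jap_sub_le {d : ℕ} (x w : Ed d) : |jap (x - w) - jap x| ≤ ‖w‖ := by
  have h₁ := jap_le_add_norm x (x - w)
  have h₂ := jap_le_add_norm (x - w) x
  rw [sub_sub_cancel_left, norm_neg] at h₁
  rw [sub_sub_cancel] at h₂
  exact abs_le.2 ⟨by linarith, by linarith⟩

/-- The tangent-line bound for `⟨·⟩`. -/
lemma jap_sub_sub_le {d : ℕ} (x w : Ed d) :
    jap (x - w) - jap x ≤ -(inner ℝ x w / jap x) + ‖w‖ ^ 2 / 2 := by
  have hx := one_le_jap x
  have hpos : 0 < jap x := by linarith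
  have hsq : jap (x - w) ^ 2 = jap x ^ 2 - 2 * inner ℝ x w + ‖w‖ ^ 2 := by
    rw [sq_jap, sq_jap, norm_sub_sq_real]
    ring
  have h : jap (x - w) - jap x ≤ (-2 * inner ℝ x w + ‖w‖ ^ 2) / (2 * jap x) := by
    rw [le_div_iff₀ (by positivity)]
    nlinarith [sq_nonneg (jap (x - w) - jap x)]
  have hw : ‖w‖ ^ 2 / (2 * jap x) ≤ ‖w‖ ^ 2 / 2 :=
    div_le_div_of_nonneg_left (by positivity) (by norm_num) (by linarith)
  have heq : (-2 * inner ℝ x w + ‖w‖ ^ 2) / (2 * jap x)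
      = -(inner ℝ x w / jap x) + ‖w‖ ^ 2 / (2 * jap x) := by
    field_simp
  linarith

lemma exp_le_one_add_add_sq_mul_exp_abs (u : ℝ) :
    Real.exp u ≤ 1 + u + u ^ 2 * Real.exp |u| := by
  have h₁ : Real.exp u - 1 ≤ u * Real.exp u := by
    have h := mul_le_mul_of_nonneg_right (Real.add_one_le_exp (-u)) (Real.exp_pos u).le
    rw [← Real.exp_add, neg_add_cancel, Real.exp_zero] at h
    linarith
  have h₂ := Real.add_one_le_exp u
  rcases le_total 0 u with hu | hu
  · rw [abs_of_nonneg hu]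
    nlinarith [mul_le_mul_of_nonneg_left h₁ hu]
  · have h₃ := mul_le_mul_of_nonpos_left h₂ hu
    have h₄ := mul_le_mul_of_nonneg_left (Real.one_le_exp (abs_nonneg u)) (sq_nonneg u)
    linarith

/-- Second-order Taylor bound for `e^{a⟨·⟩}`, relative to `e^{a⟨x⟩}`. -/
lemma exp_jap_sub_sub_le {d : ℕ} {a : ℝ} (ha : 0 < a) (x w : Ed d) :
    Real.exp (a * jap (x - w)) - Real.exp (a * jap x) ≤
      Real.exp (a * jap x) *
        (-(a / jap x) * inner ℝ x w + (a + a ^ 2) * (‖w‖ ^ 2 * Real.exp (a * ‖w‖))) := by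
  set u := a * (jap (x - w) - jap x) with hu
  have hsplit : Real.exp (a * jap (x - w)) = Real.exp (a * jap x) * Real.exp u := by
    rw [← Real.exp_add, hu]
    ring_nf
  have habs : |u| ≤ a * ‖w‖ := by
    rw [hu, abs_mul, abs_of_pos ha]
    exact mul_le_mul_of_nonneg_left (abs_jap_sub_le x w) ha.le
  have husq : u ^ 2 ≤ a ^ 2 * ‖w‖ ^ 2 := by
    rw [← sq_abs, ← mul_pow]
    exact pow_le_pow_left₀ (abs_nonneg u) habs 2
  have hquad : u ^ 2 * Real.exp |u| ≤ a ^ 2 * ‖w‖ ^ 2 * Real.exp (a * ‖w‖) :=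
    mul_le_mul husq (Real.exp_le_exp.2 habs) (Real.exp_pos _).le (by positivity)
  have hlin : u ≤ -(a / jap x) * inner ℝ x w + a * (‖w‖ ^ 2 * Real.exp (a * ‖w‖)) := by
    have h := mul_le_mul_of_nonneg_left (jap_sub_sub_le x w) ha.le
    have hone : ‖w‖ ^ 2 / 2 ≤ ‖w‖ ^ 2 * Real.exp (a * ‖w‖) := by
      nlinarith [Real.one_le_exp (show 0 ≤ a * ‖w‖ by positivity), sq_nonneg ‖w‖]
    have h' := mul_le_mul_of_nonneg_left hone ha.le
    have heq : a * -(inner ℝ x w / jap x) = -(a / jap x) * inner ℝ x w := by ring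
    linarith
  rw [hsplit, ← mul_sub_one]
  refine mul_le_mul_of_nonneg_left ?_ (Real.exp_pos _).le
  linarith [exp_le_one_add_add_sq_mul_exp_abs u]

lemma sq_mul_exp_le {a b r : ℝ} (hab : a < b) (hr : 0 ≤ r) :
    r ^ 2 * Real.exp (a * r) ≤ 2 / (b - a) ^ 2 * Real.exp (b * r) := by
  have hpos : 0 < b - a := sub_pos.2 hab
  have h := Real.pow_div_factorial_le_exp ((b - a) * r) (by positivity) 2
  have hsq : r ^ 2 ≤ 2 / (b - a) ^ 2 * Real.exp ((b - a) * r) := by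
    rw [div_mul_eq_mul_div, le_div_iff₀ (by positivity)]
    norm_num [Nat.factorial, mul_pow] at h
    linarith
  calc r ^ 2 * Real.exp (a * r)
      ≤ 2 / (b - a) ^ 2 * Real.exp ((b - a) * r) * Real.exp (a * r) :=
        mul_le_mul_of_nonneg_right hsq (Real.exp_pos _).le
    _ = 2 / (b - a) ^ 2 * Real.exp (b * r) := by
        rw [mul_assoc, ← Real.exp_add]
        ring_nf

/-- The rescaled nonlocal operator applied to `e^{a⟨·⟩}` is bounded by a multiple of
`e^{a⟨·⟩}`, uniformly in the scale. -/
lemma exists_scaled_integral_le {d : ℕ} {a a' : ℝ} (ha : 0 < a) (haa' : a < a')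
    {J : Ed d → ℝ} (hJnn : ∀ x, 0 ≤ J x) (hJmeas : Measurable J)
    (hJm1 : ∫ x, J x • x = 0) (hJexp : Integrable (fun x => Real.exp (a' * ‖x‖) * J x)) :
    ∃ K : ℝ, 0 ≤ K ∧ ∀ ε : ℝ, 0 < ε → ε ≤ 1 → ∀ x : Ed d,
      (1 / ε ^ 2) * (∫ z, J z * (Real.exp (a * jap (x - ε • z)) - Real.exp (a * jap x))) ≤
        K * Real.exp (a * jap x) := by
  have ha' : 0 < a' := ha.trans haa'
  have hint2 : Integrable (fun z => J z * (‖z‖ ^ 2 * Real.exp (a * ‖z‖))) := by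
    refine (hJexp.const_mul (2 / (a' - a) ^ 2)).mono' (by fun_prop) (.of_forall fun z => ?_)
    have hJz := hJnn z
    rw [Real.norm_of_nonneg (by positivity)]
    nlinarith [mul_le_mul_of_nonneg_left (sq_mul_exp_le haa' (norm_nonneg z)) hJz]
  have hint1 : Integrable (fun z => J z • z) := by
    refine (hJexp.const_mul (1 / a')).mono' (by fun_prop) (.of_forall fun z => ?_)
    rw [norm_smul, Real.norm_of_nonneg (hJnn z)]
    have h : ‖z‖ ≤ 1 / a' * Real.exp (a' * ‖z‖) := by
      rw [one_div_mul_eq_div, le_div_iff₀ ha']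
      linarith [Real.add_one_le_exp (a' * ‖z‖)]
    nlinarith [mul_le_mul_of_nonneg_left h (hJnn z)]
  have hK : 0 ≤ ∫ z, J z * (‖z‖ ^ 2 * Real.exp (a * ‖z‖)) :=
    integral_nonneg fun z => mul_nonneg (hJnn z) (by positivity)
  refine ⟨(a + a ^ 2) * ∫ z, J z * (‖z‖ ^ 2 * Real.exp (a * ‖z‖)), by positivity,
    fun ε hε hε1 x => ?_⟩
  set φ := Real.exp (a * jap x) with hφ
  have hφpos : 0 < φ := Real.exp_pos _
  have hnorm (z : Ed d) : ‖ε • z‖ = ε * ‖z‖ := by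
    rw [norm_smul, Real.norm_of_nonneg hε.le]
  have hle (z : Ed d) : ε * ‖z‖ ≤ ‖z‖ := mul_le_of_le_one_left (norm_nonneg z) hε1
  have hintL : Integrable
      (fun z => J z * (Real.exp (a * jap (x - ε • z)) - φ)) := by
    have hcont : Continuous fun z : Ed d => Real.exp (a * jap (x - ε • z)) - φ := by
      have := continuous_jap (d := d)
      fun_prop
    refine (hJexp.const_mul φ).mono'
      (hJmeas.mul hcont.measurable).aestronglyMeasurable (.of_forall fun z => ?_)
    have hup : Real.exp (a * jap (x - ε • z)) ≤ φ * Real.exp (a' * ‖z‖) := by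
      rw [hφ, ← Real.exp_add, Real.exp_le_exp]
      have h₁ := (abs_le.1 (abs_jap_sub_le x (ε • z))).2
      rw [hnorm] at h₁
      nlinarith [hle z, mul_le_mul_of_nonneg_right haa'.le (norm_nonneg z)]
    have hone : 1 ≤ Real.exp (a' * ‖z‖) := Real.one_le_exp (by positivity)
    have habs : |Real.exp (a * jap (x - ε • z)) - φ| ≤ φ * Real.exp (a' * ‖z‖) :=
      abs_le.2 ⟨by nlinarith [Real.exp_pos (a * jap (x - ε • z))], by linarith⟩
    rw [norm_mul, Real.norm_of_nonneg (hJnn z), Real.norm_eq_abs]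
    linarith [mul_le_mul_of_nonneg_left habs (hJnn z)]
  have hintI : Integrable (fun z => inner ℝ x (J z • z)) := hint1.const_inner x
  have hI : ∫ z, inner ℝ x (J z • z) = 0 := by
    rw [integral_inner hint1, hJm1, inner_zero_right]
  have hbound : ∫ z, J z * (Real.exp (a * jap (x - ε • z)) - φ) ≤
      ∫ z, (-(φ * (a / jap x) * ε) * inner ℝ x (J z • z) +
        φ * ε ^ 2 * (a + a ^ 2) * (J z * (‖z‖ ^ 2 * Real.exp (a * ‖z‖)))) := by
    refine integral_mono hintL ((hintI.const_mul _).add (hint2.const_mul _)) fun z => ?_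
    have h := exp_jap_sub_sub_le ha x (ε • z)
    rw [hnorm, inner_smul_right, ← hφ] at h
    have hexp : (ε * ‖z‖) ^ 2 * Real.exp (a * (ε * ‖z‖)) ≤
        ε ^ 2 * (‖z‖ ^ 2 * Real.exp (a * ‖z‖)) := by
      rw [mul_pow, mul_assoc]
      gcongr
      exact hle z
    calc J z * (Real.exp (a * jap (x - ε • z)) - φ)
        ≤ J z * (φ * (-(a / jap x) * (ε * inner ℝ x z) +
            (a + a ^ 2) * (ε ^ 2 * (‖z‖ ^ 2 * Real.exp (a * ‖z‖))))) := by
          refine mul_le_mul_of_nonneg_left (h.trans ?_) (hJnn z)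
          gcongr
      _ = _ := by
          rw [inner_smul_right]
          ring
  rw [integral_add (hintI.const_mul _) (hint2.const_mul _), integral_const_mul,
    integral_const_mul, hI, mul_zero, zero_add] at hbound
  rw [one_div_mul_eq_div, div_le_iff₀ (by positivity)]
  linarith

/-- Theorem 3.4 (Lyapunov condition in `L¹_{exp,a}`): if `J` satisfies the moment
normalisation (1) and `∫ J(x) e^{a'|x|} dx < ∞` for some `a' > 0`, then for every
`0 < a < a'` there are constants `C, λ > 0`, independent of `ε ∈ (0,1]`, with
`L_ε^*(e^{a⟨·⟩})(x) ≤ C - λ e^{a⟨x⟩}` for all `x`, where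
`x·∇(e^{a⟨x⟩}) = a (|x|²/⟨x⟩) e^{a⟨x⟩}`. -/
theorem lyapunov_exponential (d : ℕ) (hd : 1 ≤ d) (a' : ℝ) (ha' : 0 < a')
    (J : Ed d → ℝ) (hJnn : ∀ x, 0 ≤ J x) (hJmeas : Measurable J)
    (hJone : ∫ x, J x = 1) (hJm1 : ∫ x, J x • x = 0)
    (hJm2 : ∀ i j : Fin d, ∫ x, J x * (x i * x j) = if i = j then 2 else 0)
    (hJexp : Integrable (fun x => Real.exp (a' * ‖x‖) * J x)) :
    ∀ a : ℝ, 0 < a → a < a' →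
      ∃ C : ℝ, 0 < C ∧ ∃ lam : ℝ, 0 < lam ∧
        ∀ ε : ℝ, 0 < ε → ε ≤ 1 → ∀ x : Ed d,
          (1 / ε ^ 2) *
              (∫ z, J z * (Real.exp (a * jap (x - ε • z)) - Real.exp (a * jap x)))
              - a * (‖x‖ ^ 2 / jap x) * Real.exp (a * jap x)
            ≤ C - lam * Real.exp (a * jap x) := by
  intro a ha haa'
  obtain ⟨K, hK, hbound⟩ := exists_scaled_integral_le ha haa' hJnn hJmeas hJm1 hJexp
  refine ⟨(K + a + 1) * Real.exp (K + a + 1), by positivity, 1, one_pos, fun ε hε hε1 x => ?_⟩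
  have hx := one_le_jap x
  have hdrift : a * (jap x - 1) ≤ a * (‖x‖ ^ 2 / jap x) := by
    refine mul_le_mul_of_nonneg_left ?_ ha.le
    rw [le_div_iff₀ (by linarith)]
    nlinarith [sq_jap x]
  have hdrift' := mul_le_mul_of_nonneg_right hdrift (Real.exp_pos (a * jap x)).le
  have hconf : (K + a + 1 - a * jap x) * Real.exp (a * jap x) ≤
      (K + a + 1) * Real.exp (K + a + 1) := by
    rcases le_total (a * jap x) (K + a + 1) with h | h
    · exact mul_le_mul (by nlinarith) (Real.exp_le_exp.2 h) (Real.exp_pos _).le (by positivity)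
    · exact (mul_nonpos_of_nonpos_of_nonneg (by linarith) (Real.exp_pos _).le).trans
        (by positivity)
  linarith [hbound ε hε hε1 x]
end
end
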